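/- Let U be finite and f : 2^U → ℝ non-decreasing and ε-approximately submodular. Let S ∈ D_f (a greedy maximum differential set) with f(S) = f_max and δ_min > 0, where δ_min = min_i Δ_{s_i} f(S_{i−1}) and δ_max = max_{x ∈ U} Δ_x f(∅). Then for every C ⊆ U with f(C) = f_max, |S| < (1 + ε/δ_min + ln(δ_max/δ_min))·|C| + 1. -/

import Mathlib

/-- The prefix `{s_1, …, s_k}` of an ordered family `s : Fin n → U`. -/
def prefixSet {U : Type*} [DecidableEq U] {n : ℕ} (s : Fin n → U) (k : ℕ) : Finset U :=
  (Finset.univ.filter (fun j : Fin n => (j : ℕ) < k)).image s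

theorem prefixSet_zero {U : Type*} [DecidableEq U] {n : ℕ} (s : Fin n → U) :
    prefixSet s 0 = ∅ := by
  simp [prefixSet]

theorem prefixSet_succ {U : Type*} [DecidableEq U] {n : ℕ} (s : Fin n → U) (i : Fin n) :
    prefixSet s (i + 1) = insert (s i) (prefixSet s i) := by
  rw [prefixSet, prefixSet, ← Finset.image_insert]
  congr 1
  ext j
  simp only [Finset.mem_filter, Finset.mem_univ, true_and, Finset.mem_insert, Fin.ext_iff]
  omega

/-- If every marginal of an `ε`-approximately submodular `f` at `A` is at most `d`, then adding a
set `T` to `A` increases `f` by at most `|T| (d + ε)`. -/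
theorem approxSubmodular_union_le {U : Type*} [DecidableEq U] {f : Finset U → ℝ} {ε d : ℝ}
    (happrox : ∀ A B : Finset U, A ⊆ B → ∀ x ∉ B,
      f (insert x B) - f B ≤ f (insert x A) - f A + ε)
    {A : Finset U} (hd : ∀ u, f (insert u A) - f A ≤ d) (hdε : 0 ≤ d + ε) (T : Finset U) :
    f (A ∪ T) ≤ f A + T.card * (d + ε) := by
  induction T using Finset.induction_on with
  | empty => simp
  | insert x T hx ih =>
    rw [Finset.card_insert_of_notMem hx, Finset.union_insert]
    push_cast
    by_cases hmem : x ∈ A ∪ T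
    · rw [Finset.insert_eq_of_mem hmem]
      linarith
    · linarith [happrox A (A ∪ T) Finset.subset_union_left x hmem, hd x]

/-- If every element of the ordered family has marginal at least `d`, then `j` consecutive
elements increase `f` by at least `j * d`. -/
theorem add_mul_le_prefixSet {U : Type*} [DecidableEq U] {f : Finset U → ℝ} {n : ℕ}
    {s : Fin n → U} {d : ℝ}
    (hd : ∀ i : Fin n, d ≤ f (insert (s i) (prefixSet s i)) - f (prefixSet s i))
    {i j : ℕ} (hij : i + j ≤ n) :
    f (prefixSet s i) + j * d ≤ f (prefixSet s (i + j)) := by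
  induction j with
  | zero => simp
  | succ j ih =>
    have hstep := hd ⟨i + j, by omega⟩
    rw [← prefixSet_succ] at hstep
    have hprev := ih (by omega)
    push_cast
    rw [← add_assoc]
    simp only at hstep
    linarith

/-- The gap `a i` to the optimum, reduced by `c * e`, shrinks by a factor `1 - 1 / c` per step. -/
theorem gap_le_geometric {a : ℕ → ℝ} {c e D : ℝ} {n : ℕ} (hc : 1 ≤ c)
    (hzero : a 0 ≤ c * (D + e)) (hstep : ∀ i < n, a i ≤ c * (a i - a (i + 1) + e))
    {i : ℕ} (hi : i ≤ n) :
    a i - c * e ≤ c * D * (1 - 1 / c) ^ i := by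
  induction i with
  | zero => simpa using by linarith
  | succ i ih =>
    have hc0 : 0 < c := by linarith
    have hr : 0 ≤ 1 - 1 / c := by
      rw [sub_nonneg, div_le_one hc0]
      exact hc
    have hcontract : a (i + 1) - c * e ≤ (a i - c * e) * (1 - 1 / c) := by
      have hdiv : a i / c ≤ a i - a (i + 1) + e := (div_le_iff₀' hc0).2 (hstep i (by omega))
      have hexpand : (a i - c * e) * (1 - 1 / c) = a i - a i / c - c * e + e := by
        field_simp
        ring
      linarith
    calc a (i + 1) - c * e ≤ (a i - c * e) * (1 - 1 / c) := hcontract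
      _ ≤ c * D * (1 - 1 / c) ^ i * (1 - 1 / c) :=
        mul_le_mul_of_nonneg_right (ih (by omega)) hr
      _ = c * D * (1 - 1 / c) ^ (i + 1) := by ring

/-- Once `i ≥ c log (D / d)`, the geometric factor brings `D` down to at most `d`. -/
theorem mul_one_sub_inv_pow_le {c D d : ℝ} (hc : 1 ≤ c) (hd : 0 < d) (hD : 0 < D) {i : ℕ}
    (hi : c * Real.log (D / d) ≤ i) : D * (1 - 1 / c) ^ i ≤ d := by
  have hc0 : 0 < c := by linarith
  have hr : 0 ≤ 1 - 1 / c := by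
    rw [sub_nonneg, div_le_one hc0]
    exact hc
  have hexp : (1 - 1 / c) ^ i ≤ d / D := by
    calc (1 - 1 / c) ^ i ≤ Real.exp (-(1 / c)) ^ i :=
          pow_le_pow_left₀ hr (Real.one_sub_le_exp_neg _) i
      _ = Real.exp (-(i / c)) := by
          rw [← Real.exp_nat_mul]
          congr 1
          ring
      _ ≤ Real.exp (-Real.log (D / d)) := by
          rw [Real.exp_le_exp, neg_le_neg_iff, le_div_iff₀' hc0]
          exact hi
      _ = d / D := by rw [Real.exp_neg, Real.exp_log (div_pos hD hd), inv_div]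
  rwa [le_div_iff₀' hD] at hexp

/-- greedy approximation bound for non-decreasing
ε-approximately submodular functions:
|S| < (1 + ε/δ_min + ln(δ_max/δ_min))·|C| + 1. -/
theorem stmt5 {U : Type*} [Fintype U] [DecidableEq U] [Nonempty U]
    (f : Finset U → ℝ) (ε : ℝ) (hε : 0 ≤ ε)
    (hmono : ∀ A B : Finset U, A ⊆ B → f A ≤ f B)
    (happrox : ∀ A B : Finset U, A ⊆ B → ∀ x ∉ B,
      f (insert x B) - f B ≤ f (insert x A) - f A + ε)
    {n : ℕ} (s : Fin n → U) (hinj : Function.Injective s)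
    (hgreedy : ∀ i : Fin n, ∀ u : U,
      f (insert u (prefixSet s i)) - f (prefixSet s i) ≤
        f (insert (s i) (prefixSet s i)) - f (prefixSet s i))
    (fmax : ℝ) (hfmax : ∀ X : Finset U, f X ≤ fmax)
    (hS : f (prefixSet s n) = fmax)
    (dmin dmax : ℝ) (hdminpos : 0 < dmin)
    (hdmin : IsLeast
      {d : ℝ | ∃ i : Fin n, d = f (insert (s i) (prefixSet s i)) - f (prefixSet s i)} dmin)
    (hdmax : IsGreatest (Set.range fun x : U => f {x} - f ∅) dmax)
    (C : Finset U) (hC : f C = fmax) :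
    (n : ℝ) < (1 + ε / dmin + Real.log (dmax / dmin)) * C.card + 1 := by
  obtain ⟨⟨i₀, hi₀⟩, hle⟩ := hdmin
  have hd : ∀ i : Fin n, dmin ≤ f (insert (s i) (prefixSet s i)) - f (prefixSet s i) :=
    fun i => hle ⟨i, rfl⟩
  have hmarg : ∀ u, f (insert u ∅) - f ∅ ≤ dmax := fun u => by
    rw [insert_empty_eq]
    exact hdmax.2 ⟨u, rfl⟩
  have hdd : dmin ≤ dmax := by
    have hfirst := hd ⟨0, i₀.pos⟩
    simp only [prefixSet_zero] at hfirst
    exact hfirst.trans (hmarg _)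
  have hDpos : 0 < dmax := hdminpos.trans_le hdd
  have hgap : ∀ (A : Finset U) (d : ℝ), 0 ≤ d → (∀ u, f (insert u A) - f A ≤ d) →
      fmax - f A ≤ C.card * (d + ε) := fun A d hd0 hAd => by
    have hunion := approxSubmodular_union_le happrox hAd (by linarith) C
    have hCle := hmono C (A ∪ C) Finset.subset_union_right
    linarith
  have hc : (1 : ℝ) ≤ C.card := by
    rw [Nat.one_le_cast, Nat.one_le_iff_ne_zero]
    intro hzero
    have hC0 := hgap (prefixSet s i₀) _ (hdminpos.le.trans (hd i₀)) (hgreedy i₀)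
    rw [hzero, Nat.cast_zero, zero_mul] at hC0
    linarith [hd i₀, hfmax (insert (s i₀) (prefixSet s i₀))]
  have hc0 : (0 : ℝ) < C.card := by linarith
  have hlog : 0 ≤ Real.log (dmax / dmin) := Real.log_nonneg ((one_le_div hdminpos).2 hdd)
  have hεd : 0 ≤ ε / dmin := div_nonneg hε hdminpos.le
  set i := ⌈(C.card : ℝ) * Real.log (dmax / dmin)⌉₊ with hi
  have hi_lt : (i : ℝ) < C.card * Real.log (dmax / dmin) + 1 :=
    Nat.ceil_lt_add_one (mul_nonneg hc0.le hlog)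
  have hcε : 0 ≤ C.card * (ε / dmin) := mul_nonneg hc0.le hεd
  rcases le_total n i with hni | hin
  · have hni' : (n : ℝ) ≤ i := Nat.cast_le.2 hni
    linarith
  · have hgeom := gap_le_geometric (a := fun k => fmax - f (prefixSet s k)) (e := ε) (D := dmax)
      hc (by simpa only [prefixSet_zero] using hgap ∅ dmax hDpos.le hmarg)
      (fun k hk => by
        have hk' := hgap (prefixSet s k) _ (hdminpos.le.trans (hd ⟨k, hk⟩)) (hgreedy ⟨k, hk⟩)
        rw [← prefixSet_succ s ⟨k, hk⟩] at hk'
        simpa only [sub_sub_sub_cancel_left] using hk') hin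
    have hsmall := mul_one_sub_inv_pow_le hc hdminpos hDpos (Nat.le_ceil _)
    rw [← hi] at hsmall
    have hsmall' := mul_le_mul_of_nonneg_left hsmall hc0.le
    rw [← mul_assoc] at hsmall'
    have hrest := add_mul_le_prefixSet hd (Nat.add_sub_cancel' hin).le
    rw [Nat.add_sub_cancel' hin, hS, Nat.cast_sub hin] at hrest
    have hcount : ((n : ℝ) - i) * dmin ≤ C.card * (1 + ε / dmin) * dmin := by
      have hexpand : C.card * (1 + ε / dmin) * dmin = C.card * dmin + C.card * ε := by
        field_simp
      linarith
    linarith [le_of_mul_le_mul_right hcount hdminpos]
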